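/- arXiv:2301.12365 — 2 statements merged into one kernel-verified Lean document; each statement's English description precedes it below -/
import Mathlib

section
/- Let φ : ℝ² → ℂ be C^∞ with compact support, and define F(ω) = ∫_{ℝ²} log(A(x,ω))·φ(x) dx, where A(x,ω) = −x₁²/ω² + x₂²/(1−ω²) and log is the principal complex logarithm. Then F is holomorphic (complex differentiable) on the open set Q = {ω ∈ ℂ : Re ω ∈ (0,1), Im ω > 0}, and F extends to a function on {ω : Re ω ∈ (0,1), Im ω ≥ 0} that is C^∞ in the real sense up to the boundary Im ω = 0 (i.e. F and all of its derivatives extend continuously to Im ω = 0). -/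
open Set MeasureTheory Filter Topology

theorem locallyIntegrable_abs_log : LocallyIntegrable (fun t : ℝ => |Real.log t|) volume := by
  rw [locallyIntegrable_iff]
  intro k hk
  obtain ⟨R, hR⟩ := hk.isBounded.subset_closedBall 0
  rw [Real.closedBall_eq_Icc] at hR
  have h := (intervalIntegrable_iff' (a := 0 - R) (b := 0 + R)).1
    intervalIntegral.intervalIntegrable_log'
  exact (h.mono_set (hR.trans Icc_subset_uIcc)).abs

theorem MeasureTheory.LocallyIntegrable.comp_fst_volume {f : ℝ → ℝ} (hf : LocallyIntegrable f volume) :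
    LocallyIntegrable (fun x : ℝ × ℝ => f x.1) volume := by
  rw [locallyIntegrable_iff]
  intro k hk
  have h1 : IntegrableOn f (Prod.fst '' k) := hf.integrableOn_isCompact (hk.image continuous_fst)
  have h2 : IntegrableOn (fun _ : ℝ => (1 : ℝ)) (Prod.snd '' k) :=
    (continuous_const.locallyIntegrable).integrableOn_isCompact (hk.image continuous_snd)
  have h3 := Integrable.mul_prod h1 h2
  rw [Measure.prod_restrict] at h3
  simp only [mul_one] at h3
  exact IntegrableOn.mono_set h3 (fun x hx => ⟨⟨x, hx, rfl⟩, ⟨x, hx, rfl⟩⟩)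

theorem MeasureTheory.LocallyIntegrable.comp_snd_volume {f : ℝ → ℝ} (hf : LocallyIntegrable f volume) :
    LocallyIntegrable (fun x : ℝ × ℝ => f x.2) volume := by
  rw [locallyIntegrable_iff]
  intro k hk
  have h1 : IntegrableOn f (Prod.snd '' k) := hf.integrableOn_isCompact (hk.image continuous_snd)
  have h2 : IntegrableOn (fun _ : ℝ => (1 : ℝ)) (Prod.fst '' k) :=
    (continuous_const.locallyIntegrable).integrableOn_isCompact (hk.image continuous_fst)
  have h3 := Integrable.mul_prod h2 h1
  rw [Measure.prod_restrict] at h3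
  simp only [one_mul] at h3
  exact IntegrableOn.mono_set h3 (fun x hx => ⟨⟨x, hx, rfl⟩, ⟨x, hx, rfl⟩⟩)

theorem Complex.norm_log_le_of_le_norm {z : ℂ} {t : ℝ} (ht : 0 < t) (htz : t ≤ ‖z‖) :
    ‖Complex.log z‖ ≤ |Real.log t| + ‖z‖ + Real.pi := by
  have h1 := Complex.norm_le_abs_re_add_abs_im (Complex.log z)
  rw [Complex.log_re, Complex.log_im] at h1
  have h2 : |Real.log ‖z‖| ≤ |Real.log t| + ‖z‖ := by
    have h3 := Real.log_le_log ht htz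
    have h4 := Real.log_le_self (norm_nonneg z)
    have h5 := neg_abs_le (Real.log t)
    have h6 := abs_nonneg (Real.log t)
    have h7 := norm_nonneg z
    exact abs_le.2 ⟨by linarith, by linarith⟩
  have := Complex.abs_arg_le_pi z
  linarith

/-- The derivative `x₁ ∂₂Φ`, which is what an integration by parts turns `∂_c log (x₂ - c x₁)` into. -/
noncomputable def fiberDeriv (Φ : ℝ × ℝ → ℂ) (x : ℝ × ℝ) : ℂ := x.1 * fderiv ℝ Φ x (0, 1)

theorem contDiff_fiberDeriv {Φ : ℝ × ℝ → ℂ} (hΦ : ContDiff ℝ (⊤ : ℕ∞) Φ) :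
    ContDiff ℝ (⊤ : ℕ∞) (fiberDeriv Φ) := by
  have h := hΦ.fderiv_right (m := (⊤ : ℕ∞)) le_rfl
  exact (Complex.ofRealCLM.contDiff.comp contDiff_fst).mul (h.clm_apply contDiff_const)

theorem hasCompactSupport_fiberDeriv {Φ : ℝ × ℝ → ℂ} (hΦ : HasCompactSupport Φ) :
    HasCompactSupport (fiberDeriv Φ) :=
  ((hΦ.fderiv (𝕜 := ℝ)).comp_left (g := fun L : ℝ × ℝ →L[ℝ] ℂ => L (0, 1)) (by simp)).mul_left
    (f := fun x : ℝ × ℝ => (x.1 : ℂ))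

/-- Lebesgue measure on the half-plane `x₁ > 0`. -/
noncomputable abbrev halfPlaneMeasure : Measure (ℝ × ℝ) := (volume.restrict (Ioi 0)).prod volume

theorem halfPlaneMeasure_eq :
    halfPlaneMeasure = (volume : Measure (ℝ × ℝ)).restrict (Ioi 0 ×ˢ univ) := by
  rw [Measure.volume_eq_prod, ← Measure.prod_restrict, Measure.restrict_univ]

theorem ae_halfPlaneMeasure : ∀ᵐ x ∂halfPlaneMeasure, 0 < x.1 := by
  rw [halfPlaneMeasure_eq]
  filter_upwards [ae_restrict_mem (measurableSet_Ioi.prod MeasurableSet.univ)] with x hx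
  exact hx.1

theorem integrable_halfPlaneMeasure {E : Type*} [NormedAddCommGroup E] {f : ℝ × ℝ → E}
    (hf : Integrable f) :
    Integrable f halfPlaneMeasure := by
  rw [halfPlaneMeasure_eq]; exact hf.restrict

/-- The integral of `log (x₂ - c x₁) Φ(x)` over the half-plane `x₁ > 0`. -/
noncomputable def logIntegral (Φ : ℝ × ℝ → ℂ) (c : ℂ) : ℂ :=
  ∫ x, Complex.log (x.2 - c * x.1) * Φ x ∂halfPlaneMeasure

/-- Integrability of `log f · Φ` when `‖f‖` is bounded below by a multiple of a power of `|x₁|`. -/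
theorem integrable_log_mul {f Φ : ℝ × ℝ → ℂ} (hΦ : Continuous Φ) (hΦ' : HasCompactSupport Φ)
    (hf : Continuous f) {δ : ℝ} {n : ℕ} (hδ : 0 < δ) (hfδ : ∀ x, δ * |x.1| ^ n ≤ ‖f x‖) :
    Integrable (fun x => Complex.log (f x) * Φ x) := by
  refine LocallyIntegrable.integrable_smul_right_of_hasCompactSupport (𝕜 := ℂ) (E := ℂ) ?_ hΦ hΦ'
  have hB : LocallyIntegrable (fun x : ℝ × ℝ => (n : ℝ) * |Real.log x.1| +
      (|Real.log δ| + ‖f x‖ + Real.pi)) volume := by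
    refine LocallyIntegrable.add ?_ (Continuous.locallyIntegrable (by fun_prop))
    exact locallyIntegrable_abs_log.comp_fst_volume.smul (n : ℝ)
  refine hB.mono (Complex.measurable_log.comp hf.measurable).aestronglyMeasurable ?_
  have h0 : ∀ᵐ x : ℝ × ℝ, x.1 ≠ 0 := by
    rw [Measure.volume_eq_prod]
    exact Measure.quasiMeasurePreserving_fst.ae (Measure.ae_ne volume 0)
  filter_upwards [h0] with x hx
  have hx' : 0 < |x.1| ^ n := by positivity
  have h1 := Complex.norm_log_le_of_le_norm (by positivity) (hfδ x)
  rw [Real.log_mul hδ.ne' hx'.ne', Real.log_pow, Real.log_abs] at h1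
  have h2 := abs_add_le (Real.log δ) (n * Real.log x.1)
  rw [abs_mul, Nat.abs_cast] at h2
  exact (h1.trans (by linarith)).trans (le_abs_self _)

theorem integrable_log_sub_mul {Φ : ℝ × ℝ → ℂ} (hΦ : Continuous Φ) (hΦ' : HasCompactSupport Φ)
    {c : ℂ} (hc : c.im < 0) :
    Integrable (fun x : ℝ × ℝ => Complex.log (x.2 - c * x.1) * Φ x) := by
  refine integrable_log_mul hΦ hΦ' (by fun_prop) (δ := -c.im) (n := 1) (by linarith) fun x => ?_
  refine le_trans (le_of_eq ?_) (Complex.abs_im_le_norm _)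
  simp [abs_mul, abs_of_neg hc]

theorem hasDerivAt_logIntegral {Φ : ℝ × ℝ → ℂ} (hΦ : ContDiff ℝ (⊤ : ℕ∞) Φ)
    (hΦ' : HasCompactSupport Φ) {c : ℂ} (hc : c.im < 0) :
    HasDerivAt (logIntegral Φ) (logIntegral (fiberDeriv Φ) c) c := by
  have hΦc := hΦ.continuous
  set s : Set ℂ := {z | z.im < c.im / 2}
  have hs_mem : s ∈ 𝓝 c :=
    (isOpen_lt Complex.continuous_im continuous_const).mem_nhds (show c.im < c.im / 2 by linarith)
  have him : ∀ (z : ℂ) (x : ℝ × ℝ), ((x.2 : ℂ) - z * x.1).im = -z.im * x.1 := by simp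
  have key := hasDerivAt_integral_of_dominated_loc_of_deriv_le (μ := halfPlaneMeasure)
    (F := fun (c : ℂ) (x : ℝ × ℝ) => Complex.log (x.2 - c * x.1) * Φ x)
    (F' := fun (c : ℂ) (x : ℝ × ℝ) => -(x.1 : ℂ) / (x.2 - c * x.1) * Φ x)
    (bound := fun x => (2 / -c.im) * ‖Φ x‖) hs_mem ?_
    (integrable_halfPlaneMeasure (integrable_log_sub_mul hΦc hΦ' hc)) ?_ ?_ ?_ ?_
  · have hint := key.1
    refine key.2.congr_deriv (Eq.symm ?_)
    change ∫ x : ℝ × ℝ, Complex.log (x.2 - c * x.1) * fiberDeriv Φ x ∂halfPlaneMeasure = _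
    rw [integral_prod _ hint, integral_prod _ (integrable_halfPlaneMeasure
      (integrable_log_sub_mul (contDiff_fiberDeriv hΦ).continuous
        (hasCompactSupport_fiberDeriv hΦ') hc))]
    refine setIntegral_congr_fun measurableSet_Ioi fun a ha => ?_
    have ha : 0 < a := ha
    have hne : ∀ y : ℝ, (y - c * a : ℂ) ∈ Complex.slitPlane := fun y => Or.inr (by
      have := him c (a, y); simp at this; simp [hc.ne, ha.ne'])
    have hemb : IsClosedEmbedding fun y : ℝ => (a, y) :=
      Function.LeftInverse.isClosedEmbedding (f := Prod.snd) (fun _ => rfl) (by fun_prop)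
        (by fun_prop)
    have hcomp : HasCompactSupport fun y : ℝ => Φ (a, y) :=
      hΦ'.comp_isClosedEmbedding hemb
    have hcomp' : HasCompactSupport fun y : ℝ => fiberDeriv Φ (a, y) :=
      (hasCompactSupport_fiberDeriv hΦ').comp_isClosedEmbedding hemb
    have hlog : Continuous fun y : ℝ => Complex.log (y - c * a) :=
      Continuous.clog (by fun_prop) hne
    have hΦa : Continuous fun y : ℝ => Φ (a, y) := by fun_prop
    have hDa : Continuous fun y : ℝ => fiberDeriv Φ (a, y) :=
      (contDiff_fiberDeriv hΦ).continuous.comp (by fun_prop)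
    have := integral_mul_deriv_eq_deriv_mul_of_integrable
      (u := fun y : ℝ => Complex.log (y - c * a)) (u' := fun y : ℝ => 1 / (y - c * a : ℂ))
      (v := fun y : ℝ => a * Φ (a, y)) (v' := fun y : ℝ => fiberDeriv Φ (a, y)) ?_ ?_ ?_ ?_ ?_
    · simp only [this]
      rw [← integral_neg]
      congr 1; ext y; ring
    · intro y _
      exact ((Complex.ofRealCLM.hasDerivAt (x := y)).sub_const (c * a)).clog_real (hne y)
    · intro y _
      have h1 := ((hΦ.differentiable (by simp)) (a, y)).hasFDerivAt
      have h2 : HasDerivAt (fun y : ℝ => (a, y)) ((0 : ℝ), (1 : ℝ)) y :=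
        (hasDerivAt_const y a).prodMk (hasDerivAt_id y)
      exact (h1.comp_hasDerivAt y h2).const_mul (a : ℂ)
    · exact (hlog.mul hDa).integrable_of_hasCompactSupport hcomp'.mul_left
    · refine Continuous.integrable_of_hasCompactSupport ?_ (hcomp.mul_left.mul_left)
      exact (continuous_const.div (by fun_prop) fun y => Complex.slitPlane_ne_zero (hne y)).mul
        (continuous_const.mul hΦa)
    · exact (hlog.mul (continuous_const.mul hΦa)).integrable_of_hasCompactSupport
        hcomp.mul_left.mul_left
  · refine Eventually.of_forall fun z => (Measurable.mul ?_ hΦc.measurable).aestronglyMeasurable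
    exact Complex.measurable_log.comp (by fun_prop)
  · exact (Measurable.mul (by fun_prop) hΦc.measurable).aestronglyMeasurable
  · filter_upwards [ae_halfPlaneMeasure] with x hx z hz
    have hz : z.im < c.im / 2 := hz
    rw [norm_mul]
    gcongr
    have h1 := Complex.abs_im_le_norm ((x.2 : ℂ) - z * x.1)
    rw [him, abs_of_nonneg (by nlinarith)] at h1
    rw [norm_div, norm_neg, Complex.norm_real, Real.norm_eq_abs, abs_of_pos hx,
      div_le_div_iff₀ (by nlinarith) (by linarith)]
    nlinarith
  · exact integrable_halfPlaneMeasure ((hΦc.integrable_of_hasCompactSupport hΦ').norm.const_mul _)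
  · filter_upwards [ae_halfPlaneMeasure] with x hx z hz
    have hz : z.im < c.im / 2 := hz
    refine HasDerivAt.mul_const (HasDerivAt.clog ?_ (Or.inr ?_)) _
    · simpa using ((hasDerivAt_id z).mul_const (x.1 : ℂ)).const_sub (x.2 : ℂ)
    · rw [him]; nlinarith

/-- The shear `(x₁, x₂) ↦ (x₁, x₂ + r x₁)`. -/
def shear (r : ℝ) : ℝ × ℝ ≃ᵐ ℝ × ℝ where
  toFun x := (x.1, x.2 + r * x.1)
  invFun x := (x.1, x.2 - r * x.1)
  left_inv x := by simp
  right_inv x := by simp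
  measurable_toFun := by simp only [Equiv.coe_fn_mk]; fun_prop
  measurable_invFun := by simp only [Equiv.coe_fn_symm_mk]; fun_prop

theorem measurePreserving_shear (r : ℝ) :
    MeasurePreserving (shear r) halfPlaneMeasure halfPlaneMeasure :=
  MeasurePreserving.skew_product (g := fun a y => y + r * a) (MeasurePreserving.id _)
    (by fun_prop) (Eventually.of_forall fun a => (measurePreserving_add_right volume (r * a)).map_eq)

theorem logIntegral_eq_shear (Φ : ℝ × ℝ → ℂ) (c : ℂ) :
    logIntegral Φ c = ∫ x : ℝ × ℝ, Complex.log (x.2 - c.im * Complex.I * x.1) *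
      Φ (x.1, x.2 + c.re * x.1) ∂halfPlaneMeasure := by
  rw [logIntegral, ← (measurePreserving_shear c.re).integral_comp']
  congr 1; ext x
  simp only [shear, MeasurableEquiv.coe_mk, Equiv.coe_fn_mk]
  congr 2
  nth_rw 2 [← Complex.re_add_im c]
  push_cast; ring

theorem continuousWithinAt_log_im_nonneg {z : ℂ} (hz : z.re ≠ 0) :
    ContinuousWithinAt Complex.log {z | 0 ≤ z.im} z := by
  by_cases h : z ∈ Complex.slitPlane
  · exact (continuousAt_clog h).continuousWithinAt
  · rw [Complex.mem_slitPlane_iff, not_or, not_lt, not_not] at h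
    exact Complex.continuousWithinAt_log_of_re_neg_of_im_zero (lt_of_le_of_ne h.1 hz) h.2

theorem continuousOn_logIntegral {Φ : ℝ × ℝ → ℂ} (hΦ : Continuous Φ) (hΦ' : HasCompactSupport Φ) :
    ContinuousOn (logIntegral Φ) {c | c.im ≤ 0} := by
  intro c₀ hc₀
  simp only [funext (logIntegral_eq_shear Φ)]
  obtain ⟨M, hM⟩ := hΦ'.exists_bound_of_continuous hΦ
  have hM0 : 0 ≤ M := (norm_nonneg _).trans (hM 0)
  obtain ⟨R, hR⟩ : ∃ R, ∀ x, Φ x ≠ 0 → ‖x‖ ≤ R := by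
    obtain ⟨R, hR⟩ := hΦ'.isCompact.isBounded.subset_closedBall 0
    exact ⟨R, fun x hx => by simpa using hR (subset_tsupport _ hx)⟩
  set ρ := ‖c₀‖ + 1 with hρ
  have hae : ∀ᵐ x : ℝ × ℝ ∂halfPlaneMeasure, x.2 ≠ 0 :=
    Measure.quasiMeasurePreserving_snd.ae (Measure.ae_ne volume 0)
  have hre : ∀ (c : ℂ) (x : ℝ × ℝ), ((x.2 : ℂ) - c.im * Complex.I * x.1).re = x.2 := by simp
  have him : ∀ (c : ℂ) (x : ℝ × ℝ), ((x.2 : ℂ) - c.im * Complex.I * x.1).im = -c.im * x.1 := by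
    simp
  refine continuousWithinAt_of_dominated (bound := (Metric.closedBall 0 (R + ρ * R)).indicator
    fun x : ℝ × ℝ => (|Real.log x.2| + (R + ρ * R + ρ * R) + Real.pi) * M) ?_ ?_ ?_ ?_
  · refine Eventually.of_forall fun c => (Measurable.mul ?_ ?_).aestronglyMeasurable
    · exact Complex.measurable_log.comp (by fun_prop)
    · exact hΦ.measurable.comp (by fun_prop)
  · filter_upwards [mem_nhdsWithin_of_mem_nhds (Metric.ball_mem_nhds c₀ one_pos)] with c hc
    have hcρ : ‖c‖ ≤ ρ := by
      have := norm_le_norm_add_norm_sub' c c₀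
      rw [mem_ball_iff_norm] at hc; linarith
    filter_upwards [hae] with x hx
    by_cases h0 : Φ (x.1, x.2 + c.re * x.1) = 0
    · rw [h0, mul_zero, norm_zero]
      refine indicator_nonneg (fun y hy => ?_) x
      have h1 : 0 ≤ R + ρ * R := by
        have := (norm_nonneg y).trans (mem_closedBall_zero_iff.1 hy); exact this
      have hR0 : 0 ≤ R := by
        by_contra! hneg
        have : 0 < ρ := by positivity
        nlinarith
      positivity
    · have h1 := hR _ h0
      have hx1 : |x.1| ≤ R := (norm_fst_le (x.1, x.2 + c.re * x.1)).trans h1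
      have hx2 : |x.2 + c.re * x.1| ≤ R := (norm_snd_le (x.1, x.2 + c.re * x.1)).trans h1
      have hR0 : 0 ≤ R := (abs_nonneg _).trans hx1
      have hrx : |c.re * x.1| ≤ ρ * R := by
        rw [abs_mul]
        exact mul_le_mul ((Complex.abs_re_le_norm c).trans hcρ) hx1 (abs_nonneg _) (by positivity)
      have hix : |c.im * x.1| ≤ ρ * R := by
        rw [abs_mul]
        exact mul_le_mul ((Complex.abs_im_le_norm c).trans hcρ) hx1 (abs_nonneg _) (by positivity)
      have hx2' : |x.2| ≤ R + ρ * R := by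
        have := abs_sub (x.2 + c.re * x.1) (c.re * x.1)
        rw [add_sub_cancel_right] at this
        linarith
      have hmem : x ∈ Metric.closedBall (0 : ℝ × ℝ) (R + ρ * R) := by
        rw [mem_closedBall_zero_iff]
        refine norm_prod_le_iff.2 ⟨hx1.trans ?_, hx2'⟩
        have : 0 ≤ ρ * R := by positivity
        linarith
      rw [indicator_of_mem hmem, norm_mul]
      refine mul_le_mul ?_ (hM _) (norm_nonneg _) (by positivity)
      have hz := Complex.norm_log_le_of_le_norm (z := x.2 - c.im * Complex.I * x.1)
        (abs_pos.2 hx) (by have := Complex.abs_re_le_norm (x.2 - c.im * Complex.I * x.1 : ℂ)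
                           rwa [hre] at this)
      have hz' := Complex.norm_le_abs_re_add_abs_im (x.2 - c.im * Complex.I * x.1 : ℂ)
      rw [hre, him, neg_mul, abs_neg] at hz'
      rw [Real.log_abs] at hz
      linarith
  · refine integrable_halfPlaneMeasure ?_
    rw [integrable_indicator_iff Metric.isClosed_closedBall.measurableSet]
    have hB : LocallyIntegrable (fun x : ℝ × ℝ => |Real.log x.2| + (R + ρ * R + ρ * R) + Real.pi) :=
      (locallyIntegrable_abs_log.comp_snd_volume.add
        (continuous_const.locallyIntegrable)).add continuous_const.locallyIntegrable
    exact (hB.integrableOn_isCompact (isCompact_closedBall _ _)).mul_const M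
  · filter_upwards [hae, ae_halfPlaneMeasure] with x hx hx1
    refine ContinuousWithinAt.mul ?_ (Continuous.continuousWithinAt (by fun_prop))
    refine ContinuousWithinAt.comp (t := {z : ℂ | 0 ≤ z.im}) (g := Complex.log)
      (f := fun c : ℂ => (x.2 : ℂ) - c.im * Complex.I * x.1)
      (continuousWithinAt_log_im_nonneg (by rwa [hre]))
      (Continuous.continuousWithinAt (by fun_prop)) fun c hc => ?_
    have hc : c.im ≤ 0 := hc
    change 0 ≤ Complex.im _
    rw [him]; nlinarith

theorem hasFDerivWithinAt_logIntegral {Φ : ℝ × ℝ → ℂ} (hΦ : ContDiff ℝ (⊤ : ℕ∞) Φ)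
    (hΦ' : HasCompactSupport Φ) {c : ℂ} (hc : c.im ≤ 0) :
    HasFDerivWithinAt (logIntegral Φ) (ContinuousLinearMap.mul ℝ ℂ (logIntegral (fiberDeriv Φ) c))
      {c | c.im ≤ 0} c := by
  have hcl : closure {z : ℂ | z.im < 0} = {z | z.im ≤ 0} := Complex.closure_setOfPred_im_lt 0
  have hsub : {z : ℂ | z.im < 0} ⊆ {z | z.im ≤ 0} := fun z (hz : z.im < 0) => show z.im ≤ 0 from hz.le
  have hd : ∀ z : ℂ, z.im < 0 → HasFDerivAt (logIntegral Φ)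
      (ContinuousLinearMap.mul ℝ ℂ (logIntegral (fiberDeriv Φ) z)) z := fun z hz => by
    refine ((hasDerivAt_logIntegral hΦ hΦ' hz).hasFDerivAt.restrictScalars ℝ).congr_fderiv ?_
    ext w
    simp [mul_comm]
  rw [← hcl]
  refine hasFDerivWithinAt_closure_of_tendsto_fderiv
    (fun z hz => (hd z hz).differentiableAt.differentiableWithinAt) (convex_halfSpace_im_lt 0)
    (isOpen_lt Complex.continuous_im continuous_const) ?_ ?_
  · rw [hcl]
    exact fun y hy => (continuousOn_logIntegral hΦ.continuous hΦ' y hy).mono hsub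
  · have h1 := (continuousOn_logIntegral (contDiff_fiberDeriv hΦ).continuous
      (hasCompactSupport_fiberDeriv hΦ') c hc).mono
        hsub
    have h2 := ((ContinuousLinearMap.mul ℝ ℂ).continuous.tendsto _).comp
      h1.tendsto
    refine h2.congr' ?_
    filter_upwards [self_mem_nhdsWithin] with z hz
    exact (hd z hz).fderiv.symm

theorem contDiffOn_logIntegral {Φ : ℝ × ℝ → ℂ} (hΦ : ContDiff ℝ (⊤ : ℕ∞) Φ)
    (hΦ' : HasCompactSupport Φ) :
    ContDiffOn ℝ (⊤ : ℕ∞) (logIntegral Φ) {c | c.im ≤ 0} := by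
  rw [contDiffOn_infty]
  intro n
  induction n generalizing Φ with
  | zero => exact contDiffOn_zero.2 (continuousOn_logIntegral hΦ.continuous hΦ')
  | succ n ih =>
    push_cast
    rw [contDiffOn_succ_iff_hasFDerivWithinAt (by simp)]
    intro c hc
    refine ⟨{c | c.im ≤ 0}, by rw [insert_eq_of_mem hc]; exact self_mem_nhdsWithin, by simp, _,
      fun z hz => hasFDerivWithinAt_logIntegral hΦ hΦ' hz, ?_⟩
    exact (ContinuousLinearMap.mul ℝ ℂ).contDiff.comp_contDiffOn
      (ih (contDiff_fiberDeriv hΦ) (hasCompactSupport_fiberDeriv hΦ'))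

theorem integral_eq_integral_halfPlaneMeasure_add {f : ℝ × ℝ → ℂ} (hf : Integrable f) :
    ∫ x, f x = ∫ x, (f x + f (-x.1, x.2)) ∂halfPlaneMeasure := by
  have hmp : MeasurePreserving (Prod.map (fun t : ℝ => -t) (id : ℝ → ℝ)) volume volume :=
    (Measure.measurePreserving_neg volume).prod (MeasurePreserving.id volume)
  have hf' : Integrable fun x : ℝ × ℝ => f (-x.1, x.2) :=
    hmp.integrable_comp_of_integrable hf
  have hg := hf.integral_prod_left
  rw [integral_add (integrable_halfPlaneMeasure hf) (integrable_halfPlaneMeasure hf'),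
    integral_prod _ (integrable_halfPlaneMeasure hf),
    integral_prod _ (integrable_halfPlaneMeasure hf'), Measure.volume_eq_prod,
    integral_prod _ hf, ← intervalIntegral.integral_Iic_add_Ioi hg.integrableOn hg.integrableOn
      (b := 0), add_comm]
  congr 1
  have := integral_comp_neg_Iic 0 fun a => ∫ y, f (-a, y)
  simpa using this

theorem Complex.arg_mem_Ioo_of_im_pos {z : ℂ} (hz : 0 < z.im) : z.arg ∈ Ioo 0 Real.pi := by
  refine ⟨lt_of_le_of_ne (Complex.arg_nonneg_iff.2 hz.le) fun h => ?_,
    lt_of_le_of_ne (Complex.arg_le_pi z) fun h => ?_⟩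
  · exact hz.ne' (Complex.arg_eq_zero_iff.1 h.symm).2
  · exact hz.ne' (Complex.arg_eq_pi_iff.1 h).2

theorem Complex.log_eq_of_im_pos {A u z w : ℂ} (hA : 0 < A.im) (hu : u.im < 0) (hz : 0 < z.im)
    (hw : 0 < w.im) (h : A * u = -(z * w)) :
    Complex.log A = -Complex.log u - Real.pi * Complex.I + Complex.log z + Complex.log w := by
  have hne : ∀ {v : ℂ}, v.im ≠ 0 → v ≠ 0 := fun hv h0 => hv (by simp [h0])
  have hexp : Complex.exp (Complex.log A) = Complex.exp
      (-Complex.log u - Real.pi * Complex.I + Complex.log z + Complex.log w) := by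
    rw [Complex.exp_add, Complex.exp_add, Complex.exp_sub, Complex.exp_neg, Complex.exp_pi_mul_I,
      Complex.exp_log (hne hA.ne'), Complex.exp_log (hne hu.ne), Complex.exp_log (hne hz.ne'),
      Complex.exp_log (hne hw.ne')]
    have := hne hu.ne
    field_simp
    linear_combination h
  obtain ⟨n, hn⟩ := Complex.exp_eq_exp_iff_exists_int.1 hexp
  have him := congrArg Complex.im hn
  simp only [Complex.add_im, Complex.sub_im, Complex.neg_im, Complex.log_im, Complex.mul_im,
    Complex.ofReal_re, Complex.ofReal_im, Complex.I_re, Complex.I_im, Complex.intCast_re,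
    Complex.intCast_im, Complex.mul_re, Complex.re_ofNat, Complex.im_ofNat] at him
  obtain ⟨a1, a2⟩ := Complex.arg_mem_Ioo_of_im_pos hA
  obtain ⟨z1, z2⟩ := Complex.arg_mem_Ioo_of_im_pos hz
  obtain ⟨w1, w2⟩ := Complex.arg_mem_Ioo_of_im_pos hw
  have u1 := Complex.neg_pi_lt_arg u
  have u2 := Complex.arg_neg_iff.2 hu
  have hpi := Real.pi_pos
  have hn1 : (n : ℝ) < 1 := by nlinarith
  have hn2 : (-1 : ℝ) < n := by nlinarith
  have hn0 : n = 0 := by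
    have h1 : n < 1 := by exact_mod_cast hn1
    have h2 : -1 < n := by exact_mod_cast hn2
    omega
  rw [hn, hn0]; simp

/-- The square root of `1 / ω² - 1` lying in the closed lower half-plane, for `0 < Re ω < 1` and
`0 ≤ Im ω`. -/
noncomputable def waveSlope (ω : ℂ) : ℂ := Complex.exp (Complex.log (1 / ω ^ 2 - 1) / 2)

theorem im_sq_eq (ω : ℂ) : (ω ^ 2).im = 2 * ω.re * ω.im := by
  simp [sq]; ring

theorem im_inv_sq (ω : ℂ) : (1 / ω ^ 2).im = -(2 * ω.re * ω.im) / Complex.normSq (ω ^ 2) := by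
  rw [one_div, Complex.inv_im, im_sq_eq]

theorem ne_zero_of_re_mem {ω : ℂ} (h : ω.re ∈ Ioo (0 : ℝ) 1) : ω ≠ 0 := by
  rintro rfl; simp at h

theorem normSq_sq_pos {ω : ℂ} (h : ω.re ∈ Ioo (0 : ℝ) 1) : 0 < Complex.normSq (ω ^ 2) :=
  Complex.normSq_pos.2 (pow_ne_zero 2 (ne_zero_of_re_mem h))

theorem one_div_sq_sub_one_mem {ω : ℂ} (h : ω.re ∈ Ioo (0 : ℝ) 1) (h' : 0 ≤ ω.im) :
    1 / ω ^ 2 - 1 ∈ Complex.slitPlane := by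
  rcases h'.eq_or_lt with h0 | h0
  · obtain ⟨r, rfl⟩ : ∃ r : ℝ, (r : ℂ) = ω := ⟨ω.re, Complex.ext (by simp) (by simp [← h0])⟩
    have hr : 0 < r ∧ r < 1 := by simpa using h
    have : (1 / (r : ℂ) ^ 2 - 1) = ((1 / r ^ 2 - 1 : ℝ) : ℂ) := by push_cast; rfl
    rw [this, Complex.ofReal_mem_slitPlane, sub_pos, lt_div_iff₀ (by positivity [hr.1])]
    nlinarith
  · refine Or.inr ?_
    rw [Complex.sub_im, im_inv_sq, Complex.one_im, sub_zero]
    have := normSq_sq_pos h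
    have := h.1
    exact (div_neg_of_neg_of_pos (by simp; positivity) ‹_›).ne

theorem one_sub_sq_mem {ω : ℂ} (h : ω.re ∈ Ioo (0 : ℝ) 1) (h' : 0 ≤ ω.im) :
    1 - ω ^ 2 ∈ Complex.slitPlane := by
  rcases h'.eq_or_lt with h0 | h0
  · left
    have := h.1; have := h.2
    simp [sq, ← h0]; nlinarith
  · right
    rw [Complex.sub_im, im_sq_eq, Complex.one_im, zero_sub]
    have := h.1
    exact (neg_neg_of_pos (by positivity)).ne

theorem waveSlope_sq {ω : ℂ} (h : ω.re ∈ Ioo (0 : ℝ) 1) (h' : 0 ≤ ω.im) :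
    waveSlope ω ^ 2 = 1 / ω ^ 2 - 1 := by
  rw [waveSlope, ← Complex.exp_nat_mul]
  push_cast
  rw [mul_div_cancel₀ _ two_ne_zero, Complex.exp_log
    (Complex.slitPlane_ne_zero (one_div_sq_sub_one_mem h h'))]

theorem im_waveSlope (ω : ℂ) : (waveSlope ω).im =
    Real.exp (Complex.log (1 / ω ^ 2 - 1) / 2).re * Real.sin ((1 / ω ^ 2 - 1).arg / 2) := by
  rw [waveSlope, Complex.exp_im]
  congr 2
  rw [← Complex.log_im]
  simp

theorem waveSlope_im_neg {ω : ℂ} (h : ω.re ∈ Ioo (0 : ℝ) 1) (h' : 0 < ω.im) :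
    (waveSlope ω).im < 0 := by
  rw [im_waveSlope]
  refine mul_neg_of_pos_of_neg (Real.exp_pos _) (Real.sin_neg_of_neg_of_neg_pi_lt ?_ ?_)
  · have : (1 / ω ^ 2 - 1).arg < 0 := by
      rw [Complex.arg_neg_iff, Complex.sub_im, im_inv_sq, Complex.one_im, sub_zero]
      have := normSq_sq_pos h
      have := h.1
      exact div_neg_of_neg_of_pos (by simp; positivity) ‹_›
    linarith
  · have := Complex.neg_pi_lt_arg (1 / ω ^ 2 - 1)
    linarith [Real.pi_pos]

theorem waveSlope_im_nonpos {ω : ℂ} (h : ω.re ∈ Ioo (0 : ℝ) 1) (h' : 0 ≤ ω.im) :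
    (waveSlope ω).im ≤ 0 := by
  rcases h'.eq_or_lt with h0 | h0
  · have : (1 / ω ^ 2 - 1).im = 0 := by
      rw [Complex.sub_im, im_inv_sq, ← h0]; simp
    have hre := (Complex.mem_slitPlane_iff.1 (one_div_sq_sub_one_mem h h')).resolve_right
      (not_not_intro this)
    rw [im_waveSlope, Complex.arg_eq_zero_iff.2 ⟨hre.le, this⟩]
    simp
  · exact (waveSlope_im_neg h h0).le

theorem contDiffAt_waveSlope {ω : ℂ} (h : ω.re ∈ Ioo (0 : ℝ) 1) (h' : 0 ≤ ω.im) :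
    ContDiffAt ℂ (⊤ : ℕ∞) waveSlope ω := by
  have h1 : ContDiffAt ℂ (⊤ : ℕ∞) (fun ω : ℂ => 1 / ω ^ 2 - 1) ω :=
    ContDiffAt.sub (ContDiffAt.div contDiffAt_const (contDiffAt_id.pow 2)
      (pow_ne_zero 2 (ne_zero_of_re_mem h))) contDiffAt_const
  exact (((Complex.contDiffAt_log (one_div_sq_sub_one_mem h h')).comp ω h1).div_const 2).cexp

theorem contDiffAt_log_one_sub_sq {ω : ℂ} (h : ω.re ∈ Ioo (0 : ℝ) 1) (h' : 0 ≤ ω.im) :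
    ContDiffAt ℂ (⊤ : ℕ∞) (fun ω => Complex.log (1 - ω ^ 2)) ω :=
  (Complex.contDiffAt_log (one_sub_sq_mem h h')).comp ω
    (contDiffAt_const.sub (contDiffAt_id.pow 2))

/-- The quadratic form `-x₁² / ω² + x₂² / (1 - ω²)`. -/
noncomputable def quadSymbol (x : ℝ × ℝ) (ω : ℂ) : ℂ :=
  -(x.1 : ℂ) ^ 2 / ω ^ 2 + (x.2 : ℂ) ^ 2 / (1 - ω ^ 2)

theorem im_quadSymbol (ω : ℂ) (x : ℝ × ℝ) :
    (quadSymbol x ω).im =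
      2 * ω.re * ω.im / Complex.normSq (ω ^ 2) * x.1 ^ 2 +
        2 * ω.re * ω.im / Complex.normSq (1 - ω ^ 2) * x.2 ^ 2 := by
  have : quadSymbol x ω =
      ((-x.1 ^ 2 : ℝ) : ℂ) * (1 / ω ^ 2) + ((x.2 ^ 2 : ℝ) : ℂ) * (1 - ω ^ 2)⁻¹ := by
    rw [quadSymbol]; push_cast; ring
  rw [this, Complex.add_im, Complex.im_ofReal_mul, Complex.im_ofReal_mul, im_inv_sq,
    Complex.inv_im, Complex.sub_im, im_sq_eq, Complex.one_im]
  ring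

theorem log_quadSymbol {ω : ℂ} (h : ω.re ∈ Ioo (0 : ℝ) 1) (h' : 0 < ω.im)
    {x : ℝ × ℝ} (hx : 0 < x.1) :
    Complex.log (quadSymbol x ω) = -Complex.log (1 - ω ^ 2) - Real.pi * Complex.I +
      Complex.log (x.2 - waveSlope ω * x.1) + Complex.log (-x.2 - waveSlope ω * x.1) := by
  have hc := waveSlope_im_neg h h'
  have h1 := h.1
  apply Complex.log_eq_of_im_pos
  · rw [im_quadSymbol]
    have := normSq_sq_pos h
    have := Complex.normSq_nonneg (1 - ω ^ 2)
    positivity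
  · rw [Complex.sub_im, im_sq_eq, Complex.one_im, zero_sub]
    exact neg_neg_of_pos (by positivity)
  · simp; nlinarith
  · simp; nlinarith
  · have h2 : ω ≠ 0 := ne_zero_of_re_mem h
    have h3 := Complex.slitPlane_ne_zero (one_sub_sq_mem h h'.le)
    have h4 := waveSlope_sq h h'.le
    have h5 : -(((x.2 : ℂ) - waveSlope ω * x.1) * (-x.2 - waveSlope ω * x.1)) =
      x.2 ^ 2 - waveSlope ω ^ 2 * x.1 ^ 2 := by ring
    rw [h5, h4, quadSymbol]
    field_simp
    ring

theorem integrable_log_quadSymbol_mul {ω : ℂ} {φ : ℝ × ℝ → ℂ} (hφ : Continuous φ)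
    (hφ' : HasCompactSupport φ) (h : ω.re ∈ Ioo (0 : ℝ) 1) (h' : 0 < ω.im) :
    Integrable fun x => Complex.log (quadSymbol x ω) * φ x := by
  have h1 := h.1
  have h2 := normSq_sq_pos h
  refine integrable_log_mul hφ hφ' (by unfold quadSymbol; fun_prop)
    (δ := 2 * ω.re * ω.im / Complex.normSq (ω ^ 2)) (n := 2) (by positivity) fun x => ?_
  refine le_trans ?_ ((le_abs_self _).trans (Complex.abs_im_le_norm _))
  rw [im_quadSymbol, sq_abs, le_add_iff_nonneg_right]
  have := Complex.normSq_nonneg (1 - ω ^ 2)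
  positivity

/-- Even symmetrization of `φ` in the first variable. -/
def foldFst (φ : ℝ × ℝ → ℂ) (x : ℝ × ℝ) : ℂ := φ x + φ (-x.1, x.2)

theorem contDiff_foldFst {φ : ℝ × ℝ → ℂ} (hφ : ContDiff ℝ (⊤ : ℕ∞) φ) :
    ContDiff ℝ (⊤ : ℕ∞) (foldFst φ) :=
  hφ.add (hφ.comp (contDiff_fst.neg.prodMk contDiff_snd))

theorem hasCompactSupport_foldFst {φ : ℝ × ℝ → ℂ} (hφ : HasCompactSupport φ) :
    HasCompactSupport (foldFst φ) :=
  hφ.add (hφ.comp_isClosedEmbedding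
    ((Homeomorph.neg ℝ).prodCongr (Homeomorph.refl ℝ)).isClosedEmbedding)

theorem contDiff_reflectSnd {φ : ℝ × ℝ → ℂ} (hφ : ContDiff ℝ (⊤ : ℕ∞) φ) :
    ContDiff ℝ (⊤ : ℕ∞) fun x : ℝ × ℝ => φ (x.1, -x.2) :=
  hφ.comp (contDiff_fst.prodMk contDiff_snd.neg)

theorem hasCompactSupport_reflectSnd {φ : ℝ × ℝ → ℂ} (hφ : HasCompactSupport φ) :
    HasCompactSupport fun x : ℝ × ℝ => φ (x.1, -x.2) :=
  hφ.comp_isClosedEmbedding ((Homeomorph.refl ℝ).prodCongr (Homeomorph.neg ℝ)).isClosedEmbedding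

theorem logIntegral_reflectSnd (Φ : ℝ × ℝ → ℂ) (c : ℂ) :
    logIntegral (fun x => Φ (x.1, -x.2)) c =
      ∫ x : ℝ × ℝ, Complex.log (-x.2 - c * x.1) * Φ x ∂halfPlaneMeasure := by
  have hmp : MeasurePreserving ((MeasurableEquiv.refl ℝ).prodCongr (MeasurableEquiv.neg ℝ))
      halfPlaneMeasure halfPlaneMeasure :=
    (MeasurePreserving.id _).prod (Measure.measurePreserving_neg volume)
  rw [logIntegral, ← hmp.integral_comp']
  simp [MeasurableEquiv.prodCongr]

/-- The integral of `log (quadSymbol x ω) φ(x)`, rewritten so as to make sense up to `Im ω = 0`. -/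
noncomputable def quadPotential (φ : ℝ × ℝ → ℂ) (ω : ℂ) : ℂ :=
  (-Complex.log (1 - ω ^ 2) - Real.pi * Complex.I) * ∫ x, foldFst φ x ∂halfPlaneMeasure +
    logIntegral (foldFst φ) (waveSlope ω) +
    logIntegral (fun x => foldFst φ (x.1, -x.2)) (waveSlope ω)

theorem quadPotential_eq {ω : ℂ} {φ : ℝ × ℝ → ℂ} (hφ : ContDiff ℝ (⊤ : ℕ∞) φ)
    (hφ' : HasCompactSupport φ) (h : ω.re ∈ Ioo (0 : ℝ) 1) (h' : 0 < ω.im) :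
    quadPotential φ ω = ∫ x, Complex.log (quadSymbol x ω) * φ x := by
  have hψ := (contDiff_foldFst hφ).continuous
  have hψ' := hasCompactSupport_foldFst hφ'
  have hc := waveSlope_im_neg h h'
  rw [integral_eq_integral_halfPlaneMeasure_add
    (integrable_log_quadSymbol_mul hφ.continuous hφ' h h'), quadPotential, logIntegral_reflectSnd,
    logIntegral, ← integral_const_mul, ← integral_add, ← integral_add]
  · refine integral_congr_ae ?_
    filter_upwards [ae_halfPlaneMeasure] with x hx
    have h1 := log_quadSymbol h h' hx
    have h2 : quadSymbol (-x.1, x.2) ω = quadSymbol x ω := by simp [quadSymbol]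
    rw [h2, h1, foldFst]
    ring
  · exact integrable_halfPlaneMeasure (((hψ.integrable_of_hasCompactSupport hψ').const_mul _).add
      (integrable_log_sub_mul hψ hψ' hc))
  · refine integrable_halfPlaneMeasure (integrable_log_mul hψ hψ' (by fun_prop)
      (δ := -(waveSlope ω).im) (n := 1) (by linarith) fun x => ?_)
    refine le_trans (le_of_eq ?_) (Complex.abs_im_le_norm _)
    simp [abs_mul, abs_of_neg hc]
  · exact integrable_halfPlaneMeasure ((hψ.integrable_of_hasCompactSupport hψ').const_mul _)
  · exact integrable_halfPlaneMeasure (integrable_log_sub_mul hψ hψ' hc)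

theorem differentiableAt_quadPotential {ω : ℂ} {φ : ℝ × ℝ → ℂ} (hφ : ContDiff ℝ (⊤ : ℕ∞) φ)
    (hφ' : HasCompactSupport φ) (h : ω.re ∈ Ioo (0 : ℝ) 1) (h' : 0 < ω.im) :
    DifferentiableAt ℂ (quadPotential φ) ω := by
  have hc := waveSlope_im_neg h h'
  have hψ := contDiff_foldFst hφ
  have hψ' := hasCompactSupport_foldFst hφ'
  have hs := (contDiffAt_waveSlope h h'.le).differentiableAt (by simp)
  have hl := (contDiffAt_log_one_sub_sq h h'.le).differentiableAt (by simp)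
  exact (((hl.neg.sub_const _).mul_const _).add
    ((hasDerivAt_logIntegral hψ hψ' hc).differentiableAt.comp ω hs)).add
    ((hasDerivAt_logIntegral (contDiff_reflectSnd hψ) (hasCompactSupport_reflectSnd hψ')
      hc).differentiableAt.comp ω hs)

theorem contDiffOn_quadPotential {φ : ℝ × ℝ → ℂ} (hφ : ContDiff ℝ (⊤ : ℕ∞) φ)
    (hφ' : HasCompactSupport φ) :
    ContDiffOn ℝ (⊤ : ℕ∞) (quadPotential φ) {ω : ℂ | ω.re ∈ Ioo (0 : ℝ) 1 ∧ 0 ≤ ω.im} := by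
  have hψ := contDiff_foldFst hφ
  have hψ' := hasCompactSupport_foldFst hφ'
  have hs : ContDiffOn ℝ (⊤ : ℕ∞) waveSlope {ω : ℂ | ω.re ∈ Ioo (0 : ℝ) 1 ∧ 0 ≤ ω.im} :=
    fun ω h => ((contDiffAt_waveSlope h.1 h.2).restrict_scalars ℝ).contDiffWithinAt
  have hl : ContDiffOn ℝ (⊤ : ℕ∞) (fun ω => Complex.log (1 - ω ^ 2))
      {ω : ℂ | ω.re ∈ Ioo (0 : ℝ) 1 ∧ 0 ≤ ω.im} :=
    fun ω h => ((contDiffAt_log_one_sub_sq h.1 h.2).restrict_scalars ℝ).contDiffWithinAt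
  have hmaps : MapsTo waveSlope {ω : ℂ | ω.re ∈ Ioo (0 : ℝ) 1 ∧ 0 ≤ ω.im} {c | c.im ≤ 0} :=
    fun ω h => waveSlope_im_nonpos h.1 h.2
  exact (((hl.neg.sub contDiffOn_const).mul contDiffOn_const).add
    ((contDiffOn_logIntegral hψ hψ').comp hs hmaps)).add
    ((contDiffOn_logIntegral (contDiff_reflectSnd hψ) (hasCompactSupport_reflectSnd hψ')).comp
      hs hmaps)

theorem stmt_16 (φ : ℝ × ℝ → ℂ) (hφ : ContDiff ℝ (⊤ : ℕ∞) φ)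
    (hsupp : HasCompactSupport φ) :
    DifferentiableOn ℂ
      (fun ω : ℂ =>
        ∫ x : ℝ × ℝ,
          Complex.log (-(x.1 : ℂ) ^ 2 / ω ^ 2 + (x.2 : ℂ) ^ 2 / (1 - ω ^ 2)) * φ x)
      {ω : ℂ | ω.re ∈ Ioo (0 : ℝ) 1 ∧ 0 < ω.im} ∧
    ∃ G : ℂ → ℂ,
      ContDiffOn ℝ (⊤ : ℕ∞) G {ω : ℂ | ω.re ∈ Ioo (0 : ℝ) 1 ∧ 0 ≤ ω.im} ∧
      ∀ ω ∈ {ω : ℂ | ω.re ∈ Ioo (0 : ℝ) 1 ∧ 0 < ω.im},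
        G ω =
          ∫ x : ℝ × ℝ,
            Complex.log (-(x.1 : ℂ) ^ 2 / ω ^ 2 + (x.2 : ℂ) ^ 2 / (1 - ω ^ 2)) * φ x := by
  have heq : ∀ ω ∈ {ω : ℂ | ω.re ∈ Ioo (0 : ℝ) 1 ∧ 0 < ω.im}, quadPotential φ ω =
      ∫ x : ℝ × ℝ,
        Complex.log (-(x.1 : ℂ) ^ 2 / ω ^ 2 + (x.2 : ℂ) ^ 2 / (1 - ω ^ 2)) * φ x :=
    fun ω h => quadPotential_eq hφ hsupp h.1 h.2
  refine ⟨?_, quadPotential φ, contDiffOn_quadPotential hφ hsupp, heq⟩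
  refine DifferentiableOn.congr (fun ω h => ?_) fun ω h => (heq ω h).symm
  exact (differentiableAt_quadPotential hφ hsupp h.1 h.2).differentiableWithinAt
end

section
/- Let U = (a,b) ⊂ ℝ be an open interval containing 0, let ε₀ > 0, and let ψ : U × [0,ε₀) → ℂ be C^∞ with Re ψ(x,ε) > 0 for all (x,ε). Then for every C^∞ function φ : ℝ → ℂ with compact support contained in U, the principal value limit lim_{δ→0+} ∫_{U∖(−δ,δ)} φ(x)/x dx exists, and lim_{ε→0+} ∫_U φ(x)/(x + iε·ψ(x,ε)) dx = (lim_{δ→0+} ∫_{U∖(−δ,δ)} φ(x)/x dx) − iπ·φ(0); that is, (x + iεψ(x,ε))^{−1} converges to the distribution (x + i0)^{−1} as ε → 0+. -/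
open Set MeasureTheory Filter

lemma norm_one_sub_le_mul_norm {c M : ℝ} (hc : 0 < c) {z : ℂ} (hz : c ≤ z.re) (hM : ‖z‖ ≤ M)
    (t : ℝ) :
    ‖1 - Complex.I * t * z‖ ≤ (1 / c + M * (1 + M / c)) * ‖(t : ℂ) + Complex.I * z‖ := by
  set N := ‖(t : ℂ) + Complex.I * z‖ with hN
  have hM0 : 0 ≤ M := (norm_nonneg z).trans hM
  have h1 : c ≤ N := by
    have h := Complex.abs_im_le_norm ((t : ℂ) + Complex.I * z)
    simp at h
    exact hz.trans ((le_abs_self _).trans h)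
  have h2 : |t| ≤ N + M := by
    have h : ‖(t : ℂ)‖ ≤ ‖(t : ℂ) + Complex.I * z‖ + ‖Complex.I * z‖ := by
      simpa using norm_sub_le ((t : ℂ) + Complex.I * z) (Complex.I * z)
    simp only [Complex.norm_real, Real.norm_eq_abs, norm_mul, Complex.norm_I, one_mul] at h
    linarith
  have h3 : ‖1 - Complex.I * t * z‖ ≤ 1 + |t| * M := by
    refine (norm_sub_le _ _).trans ?_
    simp only [norm_one, norm_mul, Complex.norm_I, one_mul, Complex.norm_real, Real.norm_eq_abs]
    gcongr
  have h4 : 1 ≤ N / c := (one_le_div hc).2 h1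
  calc _ ≤ 1 + |t| * M := h3
    _ ≤ N / c + (N + M * (N / c)) * M := by
        gcongr
        exact h2.trans (by nlinarith)
    _ = _ := by ring

lemma ofReal_add_I_mul_ne_zero {z : ℂ} (hz : 0 < z.re) (t : ℝ) :
    (t : ℂ) + Complex.I * z ≠ 0 := fun h => by
  have := congrArg Complex.im h
  simp at this
  exact hz.ne' this

lemma one_add_ofReal_sq_ne_zero (t : ℝ) : (1 : ℂ) + (t : ℂ) ^ 2 ≠ 0 := by
  have : (1 + t ^ 2 : ℝ) ≠ 0 := by positivity
  exact_mod_cast this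

lemma norm_kernel_le {c M : ℝ} (hc : 0 < c) {z : ℂ} (hz : c ≤ z.re) (hM : ‖z‖ ≤ M) (t : ℝ) :
    ‖(1 - Complex.I * t * z) / (((t : ℂ) + Complex.I * z) * (1 + (t : ℂ) ^ 2))‖ ≤
      (1 / c + M * (1 + M / c)) * (1 + t ^ 2)⁻¹ := by
  have h0 : 0 < ‖(t : ℂ) + Complex.I * z‖ :=
    norm_pos_iff.2 (ofReal_add_I_mul_ne_zero (hc.trans_le hz) t)
  have h1 : ‖(1 : ℂ) + (t : ℂ) ^ 2‖ = 1 + t ^ 2 := by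
    have : ((1 : ℂ) + (t : ℂ) ^ 2) = ((1 + t ^ 2 : ℝ) : ℂ) := by push_cast; rfl
    rw [this, Complex.norm_of_nonneg (by positivity)]
  rw [norm_div, norm_mul, h1, div_mul_eq_div_div, ← div_eq_mul_inv]
  gcongr
  rw [div_le_iff₀ h0]
  exact norm_one_sub_le_mul_norm hc hz hM t

lemma integral_kernel {w : ℂ} (hw : 0 < w.re) :
    ∫ t : ℝ, (1 - Complex.I * t * w) / (((t : ℂ) + Complex.I * w) * (1 + (t : ℂ) ^ 2)) =
      -(Real.pi * Complex.I) := by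
  have hcont : Continuous fun t : ℝ =>
      (1 - Complex.I * t * w) / (((t : ℂ) + Complex.I * w) * (1 + (t : ℂ) ^ 2)) :=
    Continuous.div (by fun_prop) (by fun_prop) fun t =>
      mul_ne_zero (ofReal_add_I_mul_ne_zero hw t) (one_add_ofReal_sq_ne_zero t)
  have hint := (integrable_inv_one_add_sq.const_mul (1 / w.re + ‖w‖ * (1 + ‖w‖ / w.re))).mono'
    hcont.aestronglyMeasurable (ae_of_all _ fun t => norm_kernel_le hw le_rfl le_rfl t)
  let G : ℝ → ℂ := fun θ => w * Real.cos θ - Complex.I * Real.sin θ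
  have hG : Continuous G := by fun_prop
  have hderiv : ∀ t : ℝ, HasDerivAt (fun t => Complex.log (G (Real.arctan t)))
      ((1 - Complex.I * t * w) / (((t : ℂ) + Complex.I * w) * (1 + (t : ℂ) ^ 2))) t := by
    intro t
    have hcos := Real.cos_arctan_pos t
    have hre : 0 < (G (Real.arctan t)).re := by
      simp only [G, Complex.sub_re, Complex.re_mul_ofReal, Complex.I_re, zero_mul, sub_zero]
      positivity
    have hsin : Real.sin (Real.arctan t) = t * Real.cos (Real.arctan t) := by
      rw [Real.sin_arctan, Real.cos_arctan]; ring
    have h1 : HasDerivAt G (w * ((-Real.sin (Real.arctan t) : ℝ) : ℂ)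
        - Complex.I * (Real.cos (Real.arctan t) : ℂ)) (Real.arctan t) :=
      ((Real.hasDerivAt_cos _).ofReal_comp.const_mul w).sub
        ((Real.hasDerivAt_sin _).ofReal_comp.const_mul Complex.I)
    have h2 := (h1.scomp t (Real.hasDerivAt_arctan t)).clog_real (Or.inl hre)
    refine h2.congr_deriv (Eq.symm ?_)
    have ht := ofReal_add_I_mul_ne_zero hw t
    have ht2 := one_add_ofReal_sq_ne_zero t
    have hc' : (Real.cos (Real.arctan t) : ℂ) ≠ 0 := by exact_mod_cast hcos.ne'
    have hGe : G (Real.arctan t) =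
        -Complex.I * (Real.cos (Real.arctan t) : ℂ) * (t + Complex.I * w) := by
      simp only [G, hsin, Complex.ofReal_mul]
      linear_combination (w * (Real.cos (Real.arctan t) : ℂ)) * Complex.I_sq
    simp only [Function.comp]
    rw [hGe, hsin, Complex.real_smul]
    simp only [Complex.ofReal_mul, Complex.ofReal_neg, Complex.ofReal_div, Complex.ofReal_add,
      Complex.ofReal_one, Complex.ofReal_pow]
    have hI := Complex.I_ne_zero
    field_simp
    linear_combination (-(t * w)) * Complex.I_sq
  have hlim : ∀ {l : Filter ℝ} {θ : ℝ}, Tendsto Real.arctan l (nhds θ) →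
      G θ ∈ Complex.slitPlane →
      Tendsto (fun t => Complex.log (G (Real.arctan t))) l (nhds (Complex.log (G θ))) :=
    fun h hθ => ((hG.tendsto _).comp h).clog hθ
  have e1 : G (Real.pi / 2) = -Complex.I := by simp [G, -Complex.ofReal_cos, -Complex.ofReal_sin]
  have e2 : G (-(Real.pi / 2)) = Complex.I := by simp [G, -Complex.ofReal_cos, -Complex.ofReal_sin]
  have l1 := hlim (tendsto_nhds_of_tendsto_nhdsWithin Real.tendsto_arctan_atBot)
    (by rw [e2]; simp [Complex.slitPlane])
  have l2 := hlim (tendsto_nhds_of_tendsto_nhdsWithin Real.tendsto_arctan_atTop)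
    (by rw [e1]; simp [Complex.slitPlane])
  rw [integral_of_hasDerivAt_of_tendsto hderiv hint l1 l2, e1, e2, Complex.log_I,
    Complex.log_neg_I]
  ring

lemma integrableOn_div_ofReal {φ : ℝ → ℂ} (hφ : Integrable φ) {δ : ℝ} (hδ : 0 < δ) {s : Set ℝ}
    (hs : MeasurableSet s) (hsδ : ∀ x ∈ s, δ ≤ |x|) :
    IntegrableOn (fun x : ℝ => φ x / (x : ℂ)) s := by
  refine (hφ.norm.const_mul δ⁻¹).integrableOn.mono'
    (hφ.aestronglyMeasurable.div₀ (by fun_prop)).restrict ?_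
  filter_upwards [ae_restrict_mem hs] with x hx
  rw [norm_div, Complex.norm_real, Real.norm_eq_abs, div_eq_inv_mul]
  gcongr
  exact hsδ x hx

lemma integrableOn_Ioi_div {φ : ℝ → ℂ} (hφ : Integrable φ) {δ : ℝ} (hδ : 0 < δ) :
    IntegrableOn (fun x : ℝ => φ x / (x : ℂ)) (Ioi δ) :=
  integrableOn_div_ofReal hφ hδ measurableSet_Ioi fun x hx =>
    (le_of_lt (mem_Ioi.1 hx)).trans (le_abs_self x)

lemma integral_compl_Ioo_div {φ : ℝ → ℂ} (hφ : Integrable φ) {δ : ℝ} (hδ : 0 < δ) :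
    ∫ x in (Ioo (-δ) δ)ᶜ, φ x / (x : ℂ) = ∫ x in Ioi δ, (φ x - φ (-x)) / (x : ℂ) := by
  have h1 := integrableOn_div_ofReal hφ hδ measurableSet_Ici fun x hx =>
    (mem_Ici.1 hx).trans (le_abs_self x)
  have h2 := integrableOn_div_ofReal hφ hδ measurableSet_Iic fun x hx =>
    le_abs.2 (Or.inr (le_neg_of_le_neg (mem_Iic.1 hx)))
  have hset : (Ioo (-δ) δ)ᶜ = Iic (-δ) ∪ Ici δ := by
    ext x
    simp only [mem_compl_iff, mem_Ioo, not_and_or, not_lt, mem_union, mem_Iic, mem_Ici]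
  rw [hset, setIntegral_union (Iic_disjoint_Ici.2 (by linarith)) measurableSet_Ici h2 h1,
    integral_Ici_eq_integral_Ioi, ← integral_comp_neg_Ioi, ← integral_add
      (by simpa [div_neg, IntegrableOn] using (integrableOn_Ioi_div hφ.comp_neg hδ).neg)
      (h1.mono_set Ioi_subset_Ici_self)]
  congr 1 with x
  push_cast
  rw [div_neg]
  ring

lemma norm_odd_div_le {φ : ℝ → ℂ} {C : NNReal} (h : LipschitzWith C φ) {x : ℝ} (hx : 0 < x) :
    ‖(φ x - φ (-x)) / (x : ℂ)‖ ≤ 2 * C := by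
  rw [norm_div, Complex.norm_of_nonneg hx.le, div_le_iff₀ hx]
  have := h.norm_sub_le x (-x)
  rw [sub_neg_eq_add, Real.norm_of_nonneg (by positivity)] at this
  linarith

lemma integrableOn_odd_div {φ : ℝ → ℂ} {C : NNReal} (h : LipschitzWith C φ)
    (hc : HasCompactSupport φ) :
    IntegrableOn (fun x : ℝ => (φ x - φ (-x)) / (x : ℂ)) (Ioi 0) := by
  have hφ : Integrable φ := h.continuous.integrable_of_hasCompactSupport hc
  rw [← Ioc_union_Ioi_eq_Ioi zero_le_one]
  refine IntegrableOn.union ?_ ?_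
  · refine Measure.integrableOn_of_bounded (M := 2 * C) (by simp) ?_ ?_
    · exact (hφ.sub hφ.comp_neg).aestronglyMeasurable.div₀ (by fun_prop)
    · filter_upwards [ae_restrict_mem measurableSet_Ioc] with x hx
      exact norm_odd_div_le h hx.1
  · exact integrableOn_Ioi_div (hφ.sub hφ.comp_neg) one_pos

lemma tendsto_integral_compl_Ioo_div {φ : ℝ → ℂ} {C : NNReal} (h : LipschitzWith C φ)
    (hc : HasCompactSupport φ) :
    Tendsto (fun δ : ℝ => ∫ x in (Ioo (-δ) δ)ᶜ, φ x / (x : ℂ)) (nhdsWithin 0 (Ioi 0))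
      (nhds (∫ x in Ioi 0, (φ x - φ (-x)) / (x : ℂ))) := by
  have hφ : Integrable φ := h.continuous.integrable_of_hasCompactSupport hc
  have := (aecover_Ioi_of_Ioi (μ := volume)
    (tendsto_id.mono_left nhdsWithin_le_nhds : Tendsto id (nhdsWithin (0 : ℝ) (Ioi 0)) _)
    ).integral_tendsto_of_countably_generated (integrableOn_odd_div h hc)
  refine this.congr' ?_
  filter_upwards [self_mem_nhdsWithin] with δ hδ
  rw [integral_compl_Ioo_div hφ hδ, Measure.restrict_restrict measurableSet_Ioi, id,
    inter_eq_left.2 (Ioi_subset_Ioi (le_of_lt hδ))]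

lemma ofReal_sq_add_sq_ne_zero {ε : ℝ} (hε : 0 < ε) (x : ℝ) : (x : ℂ) ^ 2 + (ε : ℂ) ^ 2 ≠ 0 := by
  have : (x ^ 2 + ε ^ 2 : ℝ) ≠ 0 := by positivity
  exact_mod_cast this

lemma integrable_mul_div_sq_add_sq {φ : ℝ → ℂ} (hφ : Continuous φ) (hc : HasCompactSupport φ)
    {ε : ℝ} (hε : 0 < ε) :
    Integrable fun x : ℝ => φ x * ((x : ℂ) / ((x : ℂ) ^ 2 + (ε : ℂ) ^ 2)) :=
  (hφ.mul (Continuous.div (by fun_prop) (by fun_prop)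
    (ofReal_sq_add_sq_ne_zero hε))).integrable_of_hasCompactSupport hc.mul_right

lemma tendsto_integral_mul_div_sq_add_sq {φ : ℝ → ℂ} {C : NNReal} (h : LipschitzWith C φ)
    (hc : HasCompactSupport φ) :
    Tendsto (fun ε : ℝ => ∫ x : ℝ, φ x * ((x : ℂ) / ((x : ℂ) ^ 2 + (ε : ℂ) ^ 2)))
      (nhdsWithin 0 (Ioi 0)) (nhds (∫ x in Ioi 0, (φ x - φ (-x)) / (x : ℂ))) := by
  have hodd := integrableOn_odd_div h hc
  have key : Tendsto (fun ε : ℝ => ∫ x in Ioi (0 : ℝ),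
      (φ x - φ (-x)) / (x : ℂ) * ((x ^ 2 / (x ^ 2 + ε ^ 2) : ℝ) : ℂ))
      (nhdsWithin 0 (Ioi 0)) (nhds (∫ x in Ioi 0, (φ x - φ (-x)) / (x : ℂ))) := by
    refine tendsto_integral_filter_of_dominated_convergence _ ?_ ?_ hodd.norm ?_
    · exact Eventually.of_forall fun ε => hodd.aestronglyMeasurable.mul
        (Measurable.aestronglyMeasurable (by fun_prop))
    · refine Eventually.of_forall fun ε => ae_of_all _ fun x => ?_
      rw [norm_mul, Complex.norm_of_nonneg (by positivity)]
      refine mul_le_of_le_one_right (norm_nonneg _) (div_le_one_of_le₀ ?_ (by positivity))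
      nlinarith [sq_nonneg ε]
    · filter_upwards [ae_restrict_mem measurableSet_Ioi] with x hx
      have hx0 : (x : ℝ) ^ 2 ≠ 0 := pow_ne_zero 2 (ne_of_gt hx)
      have h1 : Tendsto (fun ε : ℝ => x ^ 2 / (x ^ 2 + ε ^ 2)) (nhdsWithin 0 (Ioi 0)) (nhds 1) := by
        have : ContinuousAt (fun ε : ℝ => x ^ 2 / (x ^ 2 + ε ^ 2)) 0 :=
          ContinuousAt.div (by fun_prop) (by fun_prop) (by simpa using hx0)
        have := this.tendsto.mono_left (nhdsWithin_le_nhds (s := Ioi 0))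
        simpa [hx0] using this
      simpa using ((Complex.continuous_ofReal.tendsto 1).comp h1).const_mul
        ((φ x - φ (-x)) / (x : ℂ))
  refine key.congr' ?_
  filter_upwards [self_mem_nhdsWithin] with ε hε
  have hint := integrable_mul_div_sq_add_sq h.continuous hc hε
  symm
  rw [← setIntegral_univ, ← Iic_union_Ioi (a := (0 : ℝ)), setIntegral_union
    (Iic_disjoint_Ioi le_rfl) measurableSet_Ioi hint.integrableOn hint.integrableOn]
  nth_rw 1 [← neg_zero]
  rw [← integral_comp_neg_Ioi, ← integral_add hint.comp_neg.integrableOn hint.integrableOn]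
  refine setIntegral_congr_fun measurableSet_Ioi fun x hx => ?_
  have hx0 : (x : ℂ) ≠ 0 := by exact_mod_cast (ne_of_gt hx)
  have := ofReal_sq_add_sq_ne_zero hε x
  push_cast
  rw [neg_sq]
  field_simp
  ring

lemma continuous_and_integrable_div_ofReal_add {φ : ℝ → ℂ} (hφ : Continuous φ) (hc : HasCompactSupport φ)
    {U : Set ℝ} (hU : IsOpen U) (hsupp : tsupport φ ⊆ U) {g : ℝ → ℂ} (hg : ContinuousOn g U)
    (hre : ∀ x ∈ U, 0 < (g x).re) {ε : ℝ} (hε : 0 < ε) :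
    Continuous (fun x : ℝ => φ x / ((x : ℂ) + Complex.I * ε * g x)) ∧
      Integrable fun x : ℝ => φ x / ((x : ℂ) + Complex.I * ε * g x) := by
  have hcont : Continuous fun x : ℝ => φ x / ((x : ℂ) + Complex.I * ε * g x) := by
    refine continuous_of_tsupport fun x hx => ?_
    have hxU : x ∈ U := by
      refine hsupp (closure_mono (fun y hy => ?_) hx)
      exact fun h0 => hy (by simp [h0])
    have hgx := hg.continuousAt (hU.mem_nhds hxU)
    refine ContinuousAt.div (by fun_prop) (by fun_prop) ?_
    rw [mul_assoc]
    refine ofReal_add_I_mul_ne_zero ?_ x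
    rw [Complex.re_ofReal_mul]
    exact mul_pos hε (hre x hxU)
  refine ⟨hcont, hcont.integrable_of_hasCompactSupport ?_⟩
  simp only [div_eq_mul_inv]
  exact hc.mul_right

lemma div_sub_mul_div_eq_kernel {ε : ℝ} (hε : 0 < ε) {z : ℂ} (hz : 0 < z.re) (p : ℂ) (t : ℝ) :
    (ε : ℂ) * (p / (((ε * t : ℝ) : ℂ) + Complex.I * ε * z) -
        p * (((ε * t : ℝ) : ℂ) / (((ε * t : ℝ) : ℂ) ^ 2 + (ε : ℂ) ^ 2))) =
      p * ((1 - Complex.I * t * z) / (((t : ℂ) + Complex.I * z) * (1 + (t : ℂ) ^ 2))) := by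
  have hε' : (ε : ℂ) ≠ 0 := by exact_mod_cast hε.ne'
  have h1 := ofReal_add_I_mul_ne_zero hz t
  have h2 := one_add_ofReal_sq_ne_zero t
  have e1 : ((ε * t : ℝ) : ℂ) + Complex.I * ε * z = ε * (t + Complex.I * z) := by push_cast; ring
  have e2 : ((ε * t : ℝ) : ℂ) ^ 2 + (ε : ℂ) ^ 2 = (ε : ℂ) ^ 2 * (1 + (t : ℂ) ^ 2) := by
    push_cast; ring
  rw [e1, e2]
  push_cast
  field_simp
  ring

lemma tendsto_integral_div_ofReal_add_sub {a b ε₀ : ℝ} (ha : a < 0) (hb : 0 < b) (hε₀ : 0 < ε₀)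
    {ψ : ℝ × ℝ → ℂ} (hψ : ContinuousOn ψ (Ioo a b ×ˢ Ico 0 ε₀))
    (hre : ∀ p ∈ Ioo a b ×ˢ Ico (0 : ℝ) ε₀, 0 < (ψ p).re)
    {φ : ℝ → ℂ} (hφ : Continuous φ) (hc : HasCompactSupport φ) (hsupp : tsupport φ ⊆ Ioo a b) :
    Tendsto (fun ε : ℝ => ∫ x : ℝ, (φ x / ((x : ℂ) + Complex.I * ε * ψ (x, ε)) -
        φ x * ((x : ℂ) / ((x : ℂ) ^ 2 + (ε : ℂ) ^ 2))))
      (nhdsWithin 0 (Ioi 0)) (nhds (φ 0 * -(Real.pi * Complex.I))) := by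
  have hK : IsCompact (tsupport φ ×ˢ Icc 0 (ε₀ / 2)) := hc.isCompact.prod isCompact_Icc
  have hKs : tsupport φ ×ˢ Icc 0 (ε₀ / 2) ⊆ Ioo a b ×ˢ Ico 0 ε₀ :=
    prod_mono hsupp (Icc_subset_Ico_right (by linarith))
  obtain ⟨M, hM⟩ := hK.exists_bound_of_continuousOn (hψ.mono hKs)
  replace hM : ∀ p ∈ tsupport φ ×ˢ Icc 0 (ε₀ / 2), ‖ψ p‖ ≤ |M| := fun p hp =>
    (hM p hp).trans (le_abs_self M)
  obtain ⟨c, hc0, hcK⟩ := hK.exists_forall_le' (f := fun p => (ψ p).re)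
    (Complex.continuous_re.comp_continuousOn (hψ.mono hKs)) (a := 0) fun p hp => hre p (hKs hp)
  obtain ⟨P, hP⟩ := hφ.bounded_above_of_compact_support hc
  have h0 : ((0 : ℝ), (0 : ℝ)) ∈ Ioo a b ×ˢ Ico 0 ε₀ := ⟨⟨ha, hb⟩, ⟨le_rfl, hε₀⟩⟩
  have hsmall : ∀ᶠ ε : ℝ in nhdsWithin 0 (Ioi 0), 0 < ε ∧ ε ≤ ε₀ / 2 := by
    filter_upwards [Ioc_mem_nhdsGT (half_pos hε₀)] with ε hε using hε
  have hscale : ∀ ε : ℝ, 0 < ε → ε ≤ ε₀ / 2 → ∀ t : ℝ,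
      (ε : ℂ) * (φ (ε * t) / (((ε * t : ℝ) : ℂ) + Complex.I * ε * ψ (ε * t, ε)) -
        φ (ε * t) * (((ε * t : ℝ) : ℂ) / (((ε * t : ℝ) : ℂ) ^ 2 + (ε : ℂ) ^ 2))) =
      φ (ε * t) * ((1 - Complex.I * t * ψ (ε * t, ε)) /
        (((t : ℂ) + Complex.I * ψ (ε * t, ε)) * (1 + (t : ℂ) ^ 2))) := by
    intro ε hε hε' t
    by_cases h : φ (ε * t) = 0
    · simp [h]
    · exact div_sub_mul_div_eq_kernel hε (hre _ (hKs 
        ⟨subset_tsupport φ (Function.mem_support.2 h), hε.le, hε'⟩)) _ _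
  have key : Tendsto (fun ε : ℝ => ∫ t : ℝ, (ε : ℂ) *
      (φ (ε * t) / (((ε * t : ℝ) : ℂ) + Complex.I * ε * ψ (ε * t, ε)) -
        φ (ε * t) * (((ε * t : ℝ) : ℂ) / (((ε * t : ℝ) : ℂ) ^ 2 + (ε : ℂ) ^ 2))))
      (nhdsWithin 0 (Ioi 0)) (nhds (∫ t : ℝ, φ 0 * ((1 - Complex.I * t * ψ (0, 0)) /
        (((t : ℂ) + Complex.I * ψ (0, 0)) * (1 + (t : ℂ) ^ 2))))) := by
    refine tendsto_integral_filter_of_dominated_convergence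
      (fun t => P * ((1 / c + |M| * (1 + |M| / c)) * (1 + t ^ 2)⁻¹)) ?_ ?_
      ((integrable_inv_one_add_sq.const_mul _).const_mul _) ?_
    · filter_upwards [hsmall] with ε ⟨hε, hε'⟩
      have hslice : ContinuousOn (fun x => ψ (x, ε)) (Ioo a b) :=
        hψ.comp (by fun_prop) fun x hx => ⟨hx, hε.le, by linarith⟩
      have h1 := (continuous_and_integrable_div_ofReal_add hφ hc isOpen_Ioo hsupp hslice
        (fun x hx => hre _ ⟨hx, hε.le, by linarith⟩) hε).1
      have h2 : Continuous fun x : ℝ => φ x * ((x : ℂ) / ((x : ℂ) ^ 2 + (ε : ℂ) ^ 2)) :=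
        hφ.mul (Continuous.div (by fun_prop) (by fun_prop) (ofReal_sq_add_sq_ne_zero hε))
      exact (continuous_const.mul ((h1.sub h2).comp (continuous_const_mul ε))).aestronglyMeasurable
    · filter_upwards [hsmall] with ε ⟨hε, hε'⟩
      refine ae_of_all _ fun t => ?_
      rw [hscale ε hε hε' t, norm_mul]
      by_cases h : φ (ε * t) = 0
      · have hP0 : 0 ≤ P := (norm_nonneg _).trans (hP 0)
        rw [h, norm_zero, zero_mul]
        positivity
      · have hmem : (ε * t, ε) ∈ tsupport φ ×ˢ Icc 0 (ε₀ / 2) :=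
          ⟨subset_tsupport φ (Function.mem_support.2 h), hε.le, hε'⟩
        exact mul_le_mul (hP _) (norm_kernel_le hc0 (hcK _ hmem) (hM _ hmem) t) (norm_nonneg _)
          ((norm_nonneg _).trans (hP 0))
    · refine ae_of_all _ fun t => ?_
      have hid : Tendsto (fun ε : ℝ => ε) (nhdsWithin 0 (Ioi 0)) (nhds 0) :=
        tendsto_id.mono_left nhdsWithin_le_nhds
      have hεt : Tendsto (fun ε : ℝ => ε * t) (nhdsWithin 0 (Ioi 0)) (nhds 0) := by
        simpa using hid.mul_const t
      have hφt : Tendsto (fun ε : ℝ => φ (ε * t)) (nhdsWithin 0 (Ioi 0)) (nhds (φ 0)) :=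
        (hφ.tendsto 0).comp hεt
      have hψt : Tendsto (fun ε : ℝ => ψ (ε * t, ε)) (nhdsWithin 0 (Ioi 0))
          (nhds (ψ (0, 0))) := by
        refine (hψ (0, 0) h0).tendsto.comp (tendsto_nhdsWithin_iff.2 ⟨hεt.prodMk_nhds hid, ?_⟩)
        filter_upwards [hsmall, hεt.eventually (Ioo_mem_nhds ha hb)] with ε ⟨hε, hε'⟩ ht
        exact ⟨ht, hε.le, by linarith⟩
      refine Tendsto.congr' (EventuallyEq.symm ?_) (hφt.mul (Tendsto.div
        (tendsto_const_nhds.sub (hψt.const_mul (Complex.I * t)))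
        ((tendsto_const_nhds.add (hψt.const_mul Complex.I)).mul tendsto_const_nhds)
        (mul_ne_zero (ofReal_add_I_mul_ne_zero (hre _ h0) t) (one_add_ofReal_sq_ne_zero t))))
      filter_upwards [hsmall] with ε ⟨hε, hε'⟩ using hscale ε hε hε' t
  rw [integral_const_mul, integral_kernel (hre _ h0)] at key
  refine key.congr' ?_
  filter_upwards [self_mem_nhdsWithin] with ε hε
  replace hε : 0 < ε := hε
  rw [integral_const_mul, Measure.integral_comp_mul_left (fun x : ℝ =>
    φ x / ((x : ℂ) + Complex.I * ε * ψ (x, ε)) - φ x * ((x : ℂ) / ((x : ℂ) ^ 2 + (ε : ℂ) ^ 2))) ε,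
    abs_of_pos (inv_pos.2 hε), Complex.real_smul, ← mul_assoc, ← Complex.ofReal_mul,
    mul_inv_cancel₀ hε.ne', Complex.ofReal_one, one_mul]

theorem stmt_17 (a b : ℝ) (ha : a < 0) (hb : 0 < b)
    (ε₀ : ℝ) (hε₀ : 0 < ε₀)
    (ψ : ℝ × ℝ → ℂ) (hψ : ContDiffOn ℝ (⊤ : ℕ∞) ψ (Ioo a b ×ˢ Ico 0 ε₀))
    (hre : ∀ p ∈ Ioo a b ×ˢ Ico (0 : ℝ) ε₀, 0 < (ψ p).re)
    (φ : ℝ → ℂ) (hφ : ContDiff ℝ (⊤ : ℕ∞) φ) (hcpt : HasCompactSupport φ)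
    (hsupp : tsupport φ ⊆ Ioo a b) :
    ∃ L : ℂ,
      Tendsto (fun δ : ℝ => ∫ x in Ioo a b \ Ioo (-δ) δ, φ x / (x : ℂ))
        (nhdsWithin 0 (Ioi 0)) (nhds L) ∧
      Tendsto
        (fun ε : ℝ =>
          ∫ x in Ioo a b, φ x / ((x : ℂ) + Complex.I * (ε : ℂ) * ψ (x, ε)))
        (nhdsWithin 0 (Ioi 0)) (nhds (L - (Real.pi : ℂ) * Complex.I * φ 0)) := by
  obtain ⟨C, hC⟩ := ContDiff.lipschitzWith_of_hasCompactSupport hcpt hφ (by simp)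
  have hzero : ∀ x ∉ Ioo a b, φ x = 0 := fun x hx =>
    image_eq_zero_of_notMem_tsupport fun h => hx (hsupp h)
  refine ⟨∫ x in Ioi 0, (φ x - φ (-x)) / (x : ℂ), ?_, ?_⟩
  · refine (tendsto_integral_compl_Ioo_div hC hcpt).congr fun δ => ?_
    refine setIntegral_eq_of_subset_of_forall_sdiff_eq_zero measurableSet_Ioo.compl
      (fun x hx => hx.2) fun x hx => ?_
    rw [hzero x fun h => hx.2 ⟨h, hx.1⟩, zero_div]
  · have h := (tendsto_integral_div_ofReal_add_sub ha hb hε₀ hψ.continuousOn hre hφ.continuous hcpt hsupp).add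
      (tendsto_integral_mul_div_sq_add_sq hC hcpt)
    rw [show ∀ L : ℂ, L - Real.pi * Complex.I * φ 0 = φ 0 * -(Real.pi * Complex.I) + L from
      fun L => by ring]
    refine h.congr' ?_
    filter_upwards [Ioo_mem_nhdsGT hε₀] with ε ⟨hε, hε'⟩
    have hslice : ContinuousOn (fun x => ψ (x, ε)) (Ioo a b) :=
      hψ.continuousOn.comp (by fun_prop) fun x hx => ⟨hx, hε.le, hε'⟩
    have hint := (continuous_and_integrable_div_ofReal_add hφ.continuous hcpt isOpen_Ioo hsupp hslice
      (fun x hx => hre _ ⟨hx, hε.le, hε'⟩) hε).2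
    rw [integral_sub hint (integrable_mul_div_sq_add_sq hφ.continuous hcpt hε), sub_add_cancel,
      setIntegral_eq_integral_of_forall_compl_eq_zero]
    intro x hx
    rw [hzero x hx, zero_div]
end
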